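/- Let A, B ⊂ ℝ² be bounded measurable sets. Then for every x ∈ ℝ², the vector-valued integral ∫_{A∖B} (x − y)/|x − y|² dy − ∫_{B∖A} (x − y)/|x − y|² dy converges absolutely and its Euclidean norm is at most 2·√(π·|A Δ B|), where A Δ B = (A∖B) ∪ (B∖A). Consequently, the difference of logarithmic potentials u(x) = (1/(2π)) ∫_A log|x − y| dy − (1/(2π)) ∫_B log|x − y| dy has gradient bounded uniformly by √(|A Δ B| / π). -/

import Mathlib

open MeasureTheory

lemma Real.abs_log_sub_log_le {a b : ℝ} (ha : 0 < a) (hb : 0 < b) :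
    |Real.log a - Real.log b| ≤ |a - b| * ((a⁻¹ + b⁻¹) / 2) := by
  wlog hab : b ≤ a generalizing a b
  · rw [abs_sub_comm, abs_sub_comm a, add_comm]
    exact this hb ha (le_of_not_ge hab)
  have hlog : Real.log b ≤ Real.log a := Real.log_le_log hb hab
  have hsinh := Real.self_le_sinh_iff.2 (sub_nonneg.2 hlog)
  rw [abs_of_nonneg (sub_nonneg.2 hlog), abs_of_nonneg (sub_nonneg.2 hab)]
  rw [← Real.log_div ha.ne' hb.ne', Real.sinh_log (div_pos ha hb)] at hsinh
  rw [← Real.log_div ha.ne' hb.ne']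
  refine hsinh.trans (le_of_eq ?_)
  field_simp
  ring

lemma Real.abs_log_le_add_inv {r : ℝ} (hr : 0 ≤ r) : |Real.log r| ≤ r + r⁻¹ := by
  have h1 := Real.log_le_self hr
  have h2 := Real.log_le_self (inv_nonneg.2 hr)
  rw [Real.log_inv] at h2
  have h3 := inv_nonneg.2 hr
  exact abs_le.2 ⟨by linarith, by linarith⟩

/-- Among planar sets of a given area, the integral of `1 / |x - y|` is largest for the disc
centred at `x`. -/
lemma lintegral_inv_norm_sub_le {E : Set (EuclideanSpace ℝ (Fin 2))} (hE : volume E ≠ ⊤)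
    (x : EuclideanSpace ℝ (Fin 2)) :
    ∫⁻ y in E, ENNReal.ofReal ‖x - y‖⁻¹
      ≤ ENNReal.ofReal (2 * Real.sqrt (Real.pi * (volume E).toReal)) := by
  rcases eq_or_ne (volume E) 0 with h0 | h0
  · simp [Measure.restrict_eq_zero.2 h0]
  have hm : 0 < (volume E).toReal := ENNReal.toReal_pos h0 hE
  set m := (volume E).toReal with hmdef
  have hEm : volume E = ENNReal.ofReal m := (ENNReal.ofReal_toReal hE).symm
  set s := Real.sqrt (Real.pi * m) with hs
  have hs2 : s ^ 2 = Real.pi * m := Real.sq_sqrt (by positivity)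
  have hspos : 0 < s := Real.sqrt_pos.2 (by positivity)
  set t := s / m with ht
  have htpos : 0 < t := by positivity
  rw [lintegral_eq_lintegral_meas_le (f := fun y => ‖x - y‖⁻¹) _
    (Filter.Eventually.of_forall fun y => by positivity) (by fun_prop),
    ← Set.Ioc_union_Ioi_eq_Ioi htpos.le]
  refine (lintegral_union_le _ _ _).trans ?_
  have hsmall : ∫⁻ u in Set.Ioc 0 t, (volume.restrict E) {y | u ≤ ‖x - y‖⁻¹}
      ≤ ENNReal.ofReal s := by
    calc _ ≤ ∫⁻ _ in Set.Ioc 0 t, volume E :=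
          lintegral_mono fun u => (measure_mono (Set.subset_univ _)).trans (by simp)
      _ = ENNReal.ofReal s := by
          rw [setLIntegral_const, Real.volume_Ioc, hEm, ← ENNReal.ofReal_mul hm.le]
          congr 1
          rw [ht]; field_simp; ring
  have hlarge : ∫⁻ u in Set.Ioi t, (volume.restrict E) {y | u ≤ ‖x - y‖⁻¹}
      ≤ ENNReal.ofReal s := by
    calc _ ≤ ∫⁻ u in Set.Ioi t, ENNReal.ofReal (Real.pi * u ^ (-2 : ℝ)) := by
          refine setLIntegral_mono (by fun_prop) fun u hu => ?_
          have hupos : 0 < u := htpos.trans hu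
          calc _ ≤ volume (Metric.closedBall x u⁻¹) := by
                refine (Measure.restrict_apply_le _ _).trans (measure_mono fun y hy => ?_)
                have hy' : u ≤ ‖x - y‖⁻¹ := hy
                rw [Metric.mem_closedBall, dist_comm, dist_eq_norm]
                exact le_inv_of_le_inv₀ hupos hy'
            _ = _ := by
                rw [EuclideanSpace.volume_closedBall_fin_two,
                  ← ENNReal.ofReal_pow (by positivity), ← ENNReal.ofReal_mul (by positivity),
                  Real.rpow_neg hupos.le, Real.rpow_two, inv_pow, mul_comm]
      _ = ENNReal.ofReal (∫ u in Set.Ioi t, Real.pi * u ^ (-2 : ℝ)) := by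
          rw [ofReal_integral_eq_lintegral_ofReal]
          · exact (integrableOn_Ioi_rpow_of_lt (by norm_num) htpos).const_mul _
          · refine (ae_restrict_mem measurableSet_Ioi).mono fun u hu => ?_
            have hupos : 0 < u := htpos.trans hu
            positivity
      _ = ENNReal.ofReal s := by
          rw [integral_const_mul, integral_Ioi_rpow_of_lt (by norm_num) htpos]
          congr 1
          norm_num [Real.rpow_neg_one]
          rw [ht]
          field_simp
          linarith
  calc _ ≤ ENNReal.ofReal s + ENNReal.ofReal s := add_le_add hsmall hlarge
    _ = _ := by rw [← ENNReal.ofReal_add hspos.le hspos.le, two_mul]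

lemma integrableOn_inv_norm_sub {E : Set (EuclideanSpace ℝ (Fin 2))} (hE : volume E ≠ ⊤)
    (x : EuclideanSpace ℝ (Fin 2)) : IntegrableOn (fun y => ‖x - y‖⁻¹) E := by
  refine ⟨by fun_prop, ?_⟩
  rw [hasFiniteIntegral_iff_ofReal (Filter.Eventually.of_forall fun y => by positivity)]
  exact (lintegral_inv_norm_sub_le hE x).trans_lt ENNReal.ofReal_lt_top

lemma setIntegral_inv_norm_sub_le {E : Set (EuclideanSpace ℝ (Fin 2))} (hE : volume E ≠ ⊤)
    (x : EuclideanSpace ℝ (Fin 2)) :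
    ∫ y in E, ‖x - y‖⁻¹ ≤ 2 * Real.sqrt (Real.pi * (volume E).toReal) := by
  rw [integral_eq_lintegral_of_nonneg_ae (Filter.Eventually.of_forall fun y => by positivity)
    (by fun_prop)]
  exact ENNReal.toReal_le_of_le_ofReal (by positivity) (lintegral_inv_norm_sub_le hE x)

lemma norm_inv_sq_norm_smul_self {F : Type*} [NormedAddCommGroup F] [NormedSpace ℝ F] (v : F) :
    ‖(‖v‖ ^ 2)⁻¹ • v‖ = ‖v‖⁻¹ := by
  rcases eq_or_ne v 0 with rfl | hv
  · simp
  have : ‖v‖ ≠ 0 := norm_ne_zero_iff.2 hv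
  rw [norm_smul, norm_inv, norm_pow, norm_norm]
  field_simp

lemma integrableOn_inv_sq_norm_smul_sub {E : Set (EuclideanSpace ℝ (Fin 2))}
    (hE : volume E ≠ ⊤) (x : EuclideanSpace ℝ (Fin 2)) :
    IntegrableOn (fun y => (‖x - y‖ ^ 2)⁻¹ • (x - y)) E :=
  (integrableOn_inv_norm_sub hE x).mono' (by fun_prop)
    (Filter.Eventually.of_forall fun y => (norm_inv_sq_norm_smul_self _).le)

lemma integrableOn_log_norm_sub {E : Set (EuclideanSpace ℝ (Fin 2))} (hE : MeasurableSet E)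
    (hb : Bornology.IsBounded E) (x : EuclideanSpace ℝ (Fin 2)) :
    IntegrableOn (fun y => Real.log ‖x - y‖) E := by
  have hfin : volume E ≠ ⊤ := hb.measure_lt_top.ne
  obtain ⟨R, hR⟩ := hb.subset_closedBall x
  refine ((integrableOn_const (C := R) hfin).add (integrableOn_inv_norm_sub hfin x)).mono'
    (Real.measurable_log.comp (by fun_prop)).aestronglyMeasurable
    ((ae_restrict_mem hE).mono fun y hy => ?_)
  have hyR : ‖x - y‖ ≤ R := by
    rw [← dist_eq_norm, dist_comm]
    exact hR hy
  rw [Real.norm_eq_abs]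
  exact (Real.abs_log_le_add_inv (norm_nonneg _)).trans (by simpa using hyR)

lemma norm_setIntegral_diff_sub_setIntegral_diff_le {α F : Type*} [MeasurableSpace α]
    [NormedAddCommGroup F] [NormedSpace ℝ F] {μ : Measure α} {A B : Set α} {f : α → F} {g : α → ℝ}
    (hA : MeasurableSet A) (hB : MeasurableSet B) (hg : IntegrableOn g (symmDiff A B) μ)
    (hfg : ∀ᵐ y ∂μ, ‖f y‖ ≤ g y) :
    ‖(∫ y in A \ B, f y ∂μ) - ∫ y in B \ A, f y ∂μ‖ ≤ ∫ y in symmDiff A B, g y ∂μ := by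
  have hdisj : Disjoint (A \ B) (B \ A) := disjoint_sdiff_sdiff
  have h1 : IntegrableOn g (A \ B) μ := hg.mono_set Set.subset_union_left
  have h2 : IntegrableOn g (B \ A) μ := hg.mono_set Set.subset_union_right
  rw [Set.symmDiff_def, setIntegral_union hdisj (hB.diff hA) h1 h2]
  exact (norm_sub_le _ _).trans (add_le_add
    (norm_integral_le_of_norm_le h1 (ae_restrict_of_ae hfg))
    (norm_integral_le_of_norm_le h2 (ae_restrict_of_ae hfg)))

lemma setIntegral_sub_setIntegral_eq_diff {α F : Type*} [MeasurableSpace α]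
    [NormedAddCommGroup F] [NormedSpace ℝ F] {μ : Measure α} {A B : Set α} {f : α → F}
    (hA : MeasurableSet A) (hB : MeasurableSet B) (hfA : IntegrableOn f A μ)
    (hfB : IntegrableOn f B μ) :
    (∫ y in A, f y ∂μ) - ∫ y in B, f y ∂μ = (∫ y in A \ B, f y ∂μ) - ∫ y in B \ A, f y ∂μ := by
  rw [← integral_inter_add_sdiff hB hfA, ← integral_inter_add_sdiff hA hfB, Set.inter_comm B A]
  abel

lemma abs_log_potential_diff_sub_le {A B : Set (EuclideanSpace ℝ (Fin 2))}
    (hA : MeasurableSet A) (hB : MeasurableSet B)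
    (hbA : Bornology.IsBounded A) (hbB : Bornology.IsBounded B)
    (w z : EuclideanSpace ℝ (Fin 2)) :
    |((∫ y in A, Real.log ‖w - y‖) - ∫ y in B, Real.log ‖w - y‖) -
        ((∫ y in A, Real.log ‖z - y‖) - ∫ y in B, Real.log ‖z - y‖)|
      ≤ 2 * Real.sqrt (Real.pi * (volume (symmDiff A B)).toReal) * ‖w - z‖ := by
  have hfin : volume (symmDiff A B) ≠ ⊤ :=
    ((hbA.union hbB).subset (symmDiff_le_sup (a := A) (b := B))).measure_lt_top.ne
  have hwA := integrableOn_log_norm_sub hA hbA w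
  have hwB := integrableOn_log_norm_sub hB hbB w
  have hzA := integrableOn_log_norm_sub hA hbA z
  have hzB := integrableOn_log_norm_sub hB hbB z
  have hw := integrableOn_inv_norm_sub hfin w
  have hz := integrableOn_inv_norm_sub hfin z
  rw [sub_sub_sub_comm, ← integral_sub hwA hzA, ← integral_sub hwB hzB,
    setIntegral_sub_setIntegral_eq_diff (f := fun y => Real.log ‖w - y‖ - Real.log ‖z - y‖)
      hA hB (hwA.sub hzA) (hwB.sub hzB), ← Real.norm_eq_abs]
  refine (norm_setIntegral_diff_sub_setIntegral_diff_le
    (g := fun y => ‖w - z‖ * ((‖w - y‖⁻¹ + ‖z - y‖⁻¹) / 2)) hA hB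
    (((hw.add hz).div_const 2).const_mul _) ?_).trans ?_
  · filter_upwards [Measure.ae_ne volume w, Measure.ae_ne volume z] with y hyw hyz
    rw [Real.norm_eq_abs]
    refine (Real.abs_log_sub_log_le (norm_pos_iff.2 (sub_ne_zero.2 hyw.symm))
      (norm_pos_iff.2 (sub_ne_zero.2 hyz.symm))).trans ?_
    gcongr
    simpa using abs_norm_sub_norm_le (w - y) (z - y)
  · rw [integral_const_mul, integral_div, integral_add hw hz, mul_comm]
    gcongr
    linarith [setIntegral_inv_norm_sub_le hfin w, setIntegral_inv_norm_sub_le hfin z]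

/-- The gradient of the difference of the logarithmic potentials of two bounded
measurable sets `A, B ⊂ ℝ²` is bounded in terms of the area of `A Δ B`. -/
theorem gradient_of_difference_of_log_potentials_bounded
    (A B : Set (EuclideanSpace ℝ (Fin 2)))
    (hA : MeasurableSet A) (hB : MeasurableSet B)
    (hbA : Bornology.IsBounded A) (hbB : Bornology.IsBounded B)
    (x : EuclideanSpace ℝ (Fin 2)) :
    IntegrableOn (fun y => (‖x - y‖ ^ 2)⁻¹ • (x - y)) (A \ B) volume ∧
    IntegrableOn (fun y => (‖x - y‖ ^ 2)⁻¹ • (x - y)) (B \ A) volume ∧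
    ‖(∫ y in A \ B, (‖x - y‖ ^ 2)⁻¹ • (x - y)) -
        ∫ y in B \ A, (‖x - y‖ ^ 2)⁻¹ • (x - y)‖
      ≤ 2 * Real.sqrt (Real.pi * (volume (symmDiff A B)).toReal) ∧
    (∀ z : EuclideanSpace ℝ (Fin 2),
      ‖gradient (fun w => (1 / (2 * Real.pi)) * (∫ y in A, Real.log ‖w - y‖) -
          (1 / (2 * Real.pi)) * (∫ y in B, Real.log ‖w - y‖)) z‖
        ≤ Real.sqrt ((volume (symmDiff A B)).toReal / Real.pi)) := by
  have hfin : volume (symmDiff A B) ≠ ⊤ :=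
    ((hbA.union hbB).subset (symmDiff_le_sup (a := A) (b := B))).measure_lt_top.ne
  refine ⟨integrableOn_inv_sq_norm_smul_sub (hbA.subset Set.sdiff_subset).measure_lt_top.ne x,
    integrableOn_inv_sq_norm_smul_sub (hbB.subset Set.sdiff_subset).measure_lt_top.ne x,
    (norm_setIntegral_diff_sub_setIntegral_diff_le hA hB (integrableOn_inv_norm_sub hfin x)
      (Filter.Eventually.of_forall fun y => (norm_inv_sq_norm_smul_self _).le)).trans
      (setIntegral_inv_norm_sub_le hfin x), fun z => ?_⟩
  set m := (volume (symmDiff A B)).toReal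
  have hconst : Real.sqrt (m / Real.pi) = 1 / (2 * Real.pi) * (2 * Real.sqrt (Real.pi * m)) := by
    have : m / Real.pi = Real.pi * m / Real.pi ^ 2 := by field_simp
    rw [this, Real.sqrt_div' _ (by positivity), Real.sqrt_sq Real.pi_pos.le]
    field_simp
  rw [gradient, LinearIsometryEquiv.norm_map]
  refine norm_fderiv_le_of_lip' ℝ (Real.sqrt_nonneg _) (Filter.Eventually.of_forall fun w => ?_)
  rw [← mul_sub, ← mul_sub, ← mul_sub, norm_mul, Real.norm_eq_abs,
    Real.norm_eq_abs, abs_of_pos (by positivity : 0 < 1 / (2 * Real.pi)), hconst, mul_assoc]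
  gcongr
  exact abs_log_potential_diff_sub_le hA hB hbA hbB w z
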